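/- Let f : ℝ → ℝ be a bounded differentiable function whose derivative f' is bounded and continuous, let μ ∈ ℝ, and let Z be a standard Gaussian random variable. Then lim_{σ → 0⁺} (1/σ)·E[f(μ + σZ)·Z] = f'(μ); equivalently, lim_{σ → 0⁺} ∫ f(a)·((a − μ)/σ²)·φ_{μ,σ²}(a) da = f'(μ), where φ_{μ,σ²} is the Gaussian density with mean μ and variance σ². -/

import Mathlib

open MeasureTheory ProbabilityTheory Filter

/-- First-order expansion in `σ` of `E[f (m + σ Z) Z]` for Lipschitz `f` and centered,
square-integrable `Z`. -/
theorem tendsto_inv_mul_integral_lipschitz_comp_mul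
    {Ω : Type*} {m0 : MeasurableSpace Ω} {P : Measure Ω} [IsFiniteMeasure P]
    {Z : Ω → ℝ} (hZ : MemLp Z 2 P) (hmean : ∫ ω, Z ω ∂P = 0)
    {f : ℝ → ℝ} {K : NNReal} (hf : LipschitzWith K f) {d m : ℝ} (hd : HasDerivAt f d m) :
    Tendsto (fun σ : ℝ => σ⁻¹ * ∫ ω, f (m + σ * Z ω) * Z ω ∂P)
      (nhdsWithin 0 {0}ᶜ) (nhds (d * ∫ ω, Z ω ^ 2 ∂P)) := by
  have hmeas (σ : ℝ) : AEStronglyMeasurable (fun ω => (f (m + σ * Z ω) - f m) * Z ω) P :=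
    ((hf.continuous.comp_aestronglyMeasurable
      (aestronglyMeasurable_const.add (hZ.1.const_mul σ))).sub aestronglyMeasurable_const).mul hZ.1
  have hbound (σ : ℝ) (ω : Ω) :
      ‖(f (m + σ * Z ω) - f m) * Z ω‖ ≤ |σ| * (K * Z ω ^ 2) := by
    have h := hf.dist_le_mul (m + σ * Z ω) m
    rw [Real.dist_eq, Real.dist_eq, add_sub_cancel_left, abs_mul] at h
    calc ‖(f (m + σ * Z ω) - f m) * Z ω‖
        = |f (m + σ * Z ω) - f m| * |Z ω| := by rw [Real.norm_eq_abs, abs_mul]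
      _ ≤ (K * (|σ| * |Z ω|)) * |Z ω| := by gcongr
      _ = |σ| * (K * Z ω ^ 2) := by rw [← sq_abs (Z ω)]; ring
  have hsq : Integrable (fun ω => K * Z ω ^ 2) P := hZ.integrable_sq.const_mul _
  have hcenter (σ : ℝ) : ∫ ω, f (m + σ * Z ω) * Z ω ∂P
      = ∫ ω, (f (m + σ * Z ω) - f m) * Z ω ∂P := by
    have hint : Integrable (fun ω => (f (m + σ * Z ω) - f m) * Z ω) P :=
      (hsq.const_mul |σ|).mono' (hmeas σ) (ae_of_all _ (hbound σ))
    have hconst : Integrable (fun ω => f m * Z ω) P := (hZ.integrable one_le_two).const_mul _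
    calc ∫ ω, f (m + σ * Z ω) * Z ω ∂P
        = ∫ ω, ((f (m + σ * Z ω) - f m) * Z ω + f m * Z ω) ∂P := by congr! 2; ring
      _ = ∫ ω, (f (m + σ * Z ω) - f m) * Z ω ∂P := by
        rw [integral_add hint hconst, integral_const_mul, hmean, mul_zero, add_zero]
  simp_rw [hcenter, ← integral_const_mul]
  refine tendsto_integral_filter_of_dominated_convergence (fun ω => K * Z ω ^ 2)
    (Eventually.of_forall fun σ => (hmeas σ).const_mul _) ?_ hsq (ae_of_all _ fun ω => ?_)
  · filter_upwards [self_mem_nhdsWithin] with σ hσ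
    refine ae_of_all _ fun ω => ?_
    rw [norm_mul, norm_inv, Real.norm_eq_abs σ, inv_mul_le_iff₀ (abs_pos.mpr hσ)]
    exact hbound σ ω
  · have hcomp : HasDerivAt (fun σ : ℝ => f (m + σ * Z ω)) (d * Z ω) 0 := by
      have hd' : HasDerivAt f d (m + 0 * Z ω) := by simpa using hd
      simpa [Function.comp_def] using hd'.comp (0 : ℝ) (((hasDerivAt_id (0 : ℝ)).mul_const (Z ω)).const_add m)
    have h := hcomp.tendsto_slope_zero.mul_const (Z ω)
    simpa [pow_two, mul_assoc] using h

/-- The one-dimensional instance of the limit claim in Proposition 3 of the paper: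
for a bounded differentiable f with bounded continuous derivative and Z a standard
Gaussian, (1/σ)·E[f(m + σZ)·Z] → f'(m) as σ → 0⁺. -/
theorem gaussian_score_limit
    {Ω : Type*} {m0 : MeasurableSpace Ω} (P : Measure Ω) [IsProbabilityMeasure P]
    (Z : Ω → ℝ) (hZ : Measurable Z)
    (hlaw : P.map Z = gaussianReal 0 1)
    (f f' : ℝ → ℝ) (hderiv : ∀ x, HasDerivAt f (f' x) x)
    (Cf : ℝ) (hfbdd : ∀ x, |f x| ≤ Cf)
    (Cf' : ℝ) (hf'bdd : ∀ x, |f' x| ≤ Cf') (hf'cont : Continuous f')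
    (m : ℝ) :
    Tendsto (fun σ : ℝ => (1 / σ) * ∫ ω, f (m + σ * Z ω) * Z ω ∂P)
      (nhdsWithin 0 (Set.Ioi 0)) (nhds (f' m)) := by
  have hlaw' : HasLaw Z (gaussianReal 0 1) P := ⟨hZ.aemeasurable, hlaw⟩
  have hmem : MemLp Z 2 P := by
    have h : MemLp id 2 (P.map Z) := hlaw ▸ memLp_id_gaussianReal 2
    exact h.comp_of_map hZ.aemeasurable
  have hmean : ∫ ω, Z ω ∂P = 0 := by
    rw [hlaw'.integral_eq, integral_id_gaussianReal]
  have hsecond : ∫ ω, Z ω ^ 2 ∂P = 1 := by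
    rw [← variance_of_integral_eq_zero hZ.aemeasurable hmean, hlaw'.variance_eq,
      variance_id_gaussianReal, NNReal.coe_one]
  have hlip : LipschitzWith Cf'.toNNReal f :=
    lipschitzWith_of_nnnorm_deriv_le (fun x => (hderiv x).differentiableAt) fun x => by
      rw [(hderiv x).deriv, ← NNReal.coe_le_coe, coe_nnnorm]
      exact (hf'bdd x).trans (Real.le_coe_toNNReal _)
  simpa [hsecond] using (tendsto_inv_mul_integral_lipschitz_comp_mul hmem hmean hlip
    (hderiv m)).mono_left (nhdsGT_le_nhdsNE 0)
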